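/- Differential privacy for data samples (Theorem 4): Fix an iteration k with state x_i^k ∈ ℝ^d and stepsize λ^k > 0, and let agent i's objective be f_i(θ; D) = (1/n_i) Σ_{j=1}^{n_i} ℓ_i(θ, s_{i,j}) for a dataset D = {s_{i,1},…,s_{i,n_i}}. Assume the per-sample gradient is ν-Lipschitz in the sample in ℓ1 norm: ‖∇ℓ_i(θ, s) − ∇ℓ_i(θ, s')‖₁ ≤ ν‖s − s'‖₁ for all θ, s, s'. Consider the Gaussian mechanism M(D) whose output distribution is that of x_i^k − λ^k ∇f_i(x_i^k; D) plus a Gaussian vector with mean zero and covariance σ² I_d. Then for any ε, δ ∈ (0,1), if σ² ≥ 2 ν² (λ^k)² ln(1.25/δ) / (n_i² ε²), the mechanism M is (ε, δ)-differentially private with respect to datasets D, D' that differ in a single sample s_p versus s_q with ‖s_p − s_q‖₁ ≤ 1: for every measurable S ⊆ ℝ^d, Prob(M(D) ∈ S) ≤ e^ε Prob(M(D') ∈ S) + δ. -/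

import Mathlib

open MeasureTheory ProbabilityTheory
open scoped NNReal

/-- The isotropic Gaussian noise measure on `EuclideanSpace ℝ (Fin d)`: every coordinate
is an independent real Gaussian with mean `0` and variance `v` (covariance `v • I_d`). -/
noncomputable def gaussianVec (d : ℕ) (v : ℝ≥0) : Measure (EuclideanSpace ℝ (Fin d)) :=
  Measure.map (⇑(EuclideanSpace.equiv (Fin d) ℝ).symm)
    (Measure.pi fun _ : Fin d => gaussianReal 0 v)

/-- The Gaussian mechanism with center `c` and per-coordinate noise variance `v`:
the distribution of `c + n` where `n ∼ 𝒩(0, v I_d)`. -/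
noncomputable def gaussianMech {d : ℕ} (v : ℝ≥0) (c : EuclideanSpace ℝ (Fin d)) :
    Measure (EuclideanSpace ℝ (Fin d)) :=
  Measure.map (fun w => c + w) (gaussianVec d v)

lemma gaussianReal_eq_withDensity_exp (m : ℝ) {v : ℝ≥0} (hv : v ≠ 0) :
    gaussianReal m v = (gaussianReal 0 v).withDensity
      (fun x => ENNReal.ofReal (Real.exp ((m * x - m ^ 2 / 2) / v))) := by
  have hv' : (v : ℝ) ≠ 0 := by exact_mod_cast hv
  rw [gaussianReal_of_var_ne_zero _ hv, gaussianReal_of_var_ne_zero _ hv,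
    ← withDensity_mul _ (measurable_gaussianPDF _ _) (by fun_prop)]
  congr 1
  ext x
  rw [Pi.mul_apply, gaussianPDF, gaussianPDF, ← ENNReal.ofReal_mul (gaussianPDFReal_nonneg _ _ _),
    gaussianPDFReal, gaussianPDFReal, mul_assoc _ (Real.exp _), ← Real.exp_add]
  congr 3
  field_simp
  ring

/-- A product of measures with densities has the product density. -/
lemma pi_withDensity_eq {ι : Type*} [Fintype ι] {X : ι → Type*} [∀ i, MeasurableSpace (X i)]
    (μ : ∀ i, Measure (X i)) [∀ i, IsProbabilityMeasure (μ i)] (f : ∀ i, X i → ENNReal)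
    (hf : ∀ i, Measurable (f i)) [∀ i, SigmaFinite ((μ i).withDensity (f i))] :
    Measure.pi (fun i => (μ i).withDensity (f i)) =
      (Measure.pi μ).withDensity (fun x => ∏ i, f i (x i)) := by
  refine Measure.pi_eq fun s hs => ?_
  have hg : ∀ i, Measurable ((s i).indicator (f i)) := fun i => (hf i).indicator (hs i)
  have key : ∀ x : ∀ i, X i, (Set.univ.pi s).indicator (fun x => ∏ i, f i (x i)) x
      = ∏ i, (s i).indicator (f i) (x i) := by
    intro x
    by_cases hx : x ∈ Set.univ.pi s
    · rw [Set.indicator_of_mem hx]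
      exact Finset.prod_congr rfl fun i _ => (Set.indicator_of_mem (hx i trivial) _).symm
    · rw [Set.indicator_of_notMem hx]
      simp only [Set.mem_pi, Set.mem_univ, true_imp_iff, not_forall] at hx
      obtain ⟨i, hi⟩ := hx
      exact (Finset.prod_eq_zero (Finset.mem_univ i) (Set.indicator_of_notMem hi _)).symm
  have hind : iIndepFun (fun i (x : ∀ i, X i) => (s i).indicator (f i) (x i)) (Measure.pi μ) :=
    iIndepFun_pi (fun i => (hg i).aemeasurable)
  rw [withDensity_apply _ (MeasurableSet.univ_pi hs),
    ← lintegral_indicator (MeasurableSet.univ_pi hs)]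
  simp_rw [key]
  rw [lintegral_prod_eq_prod_lintegral_of_indepFun Finset.univ _ hind
    (fun i => (hg i).comp (measurable_pi_apply i))]
  refine Finset.prod_congr rfl fun i _ => ?_
  rw [withDensity_apply _ (hs i), ← lintegral_indicator (hs i)]
  exact (measurePreserving_eval μ i).lintegral_comp (hg i)

instance isProbabilityMeasure_gaussianVec (d : ℕ) (v : ℝ≥0) :
    IsProbabilityMeasure (gaussianVec d v) :=
  Measure.isProbabilityMeasure_map (by fun_prop)

lemma gaussianMech_eq_withDensity {d : ℕ} {v : ℝ≥0} (hv : v ≠ 0)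
    (a : EuclideanSpace ℝ (Fin d)) :
    gaussianMech v a = (gaussianVec d v).withDensity
      (fun w => ENNReal.ofReal (Real.exp ((inner ℝ a w - ‖a‖ ^ 2 / 2) / v))) := by
  have hsig : ∀ i, SigmaFinite ((gaussianReal 0 v).withDensity
      (fun x => ENNReal.ofReal (Real.exp ((a i * x - a i ^ 2 / 2) / v)))) := fun i => by
    rw [← gaussianReal_eq_withDensity_exp _ hv]; infer_instance
  have hshift : Measure.map (fun (w : Fin d → ℝ) i => a i + w i)
      (Measure.pi fun _ : Fin d => gaussianReal 0 v) =
      (Measure.pi fun _ : Fin d => gaussianReal 0 v).withDensity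
        (fun w => ∏ i, ENNReal.ofReal (Real.exp ((a i * w i - a i ^ 2 / 2) / v))) := by
    rw [← pi_withDensity_eq (fun _ : Fin d => gaussianReal 0 v)
      (fun i x => ENNReal.ofReal (Real.exp ((a i * x - a i ^ 2 / 2) / v))) (fun i => by fun_prop)]
    simp_rw [← gaussianReal_eq_withDensity_exp _ hv]
    have : ∀ i, SigmaFinite ((gaussianReal 0 v).map (a i + ·)) := fun i => by
      rw [gaussianReal_map_const_add]; infer_instance
    rw [Measure.pi_map_pi (fun i => by fun_prop)]
    simp [gaussianReal_map_const_add]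
  have hm : Measurable (⇑(EuclideanSpace.equiv (Fin d) ℝ).symm) := by fun_prop
  ext S hS
  rw [withDensity_apply _ hS, gaussianVec, setLIntegral_map hS (by fun_prop) hm,
    gaussianMech, gaussianVec, Measure.map_map (by fun_prop) hm]
  have hcomp : (fun w => a + w) ∘ ⇑(EuclideanSpace.equiv (Fin d) ℝ).symm
      = ⇑(EuclideanSpace.equiv (Fin d) ℝ).symm ∘ (fun (w : Fin d → ℝ) i => a i + w i) := by
    ext w i; simp
  rw [hcomp, ← Measure.map_map hm (by fun_prop), hshift, Measure.map_apply hm hS,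
    withDensity_apply _ (hm hS)]
  refine lintegral_congr fun w => ?_
  rw [← ENNReal.ofReal_prod_of_nonneg (fun i _ => (Real.exp_pos _).le), ← Real.exp_sum,
    ← Finset.sum_div, Finset.sum_sub_distrib, ← Finset.sum_div, EuclideanSpace.real_norm_sq_eq]
  simp [PiLp.inner_apply, mul_comm]

lemma map_inner_gaussianVec {d : ℕ} (v : ℝ≥0) (a : EuclideanSpace ℝ (Fin d)) :
    (gaussianVec d v).map (fun w => inner ℝ a w) = gaussianReal 0 (v * ‖a‖₊ ^ 2) := by
  have : IsFiniteMeasure ((gaussianVec d v).map (fun w => inner ℝ a w)) := inferInstance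
  refine Measure.ext_of_charFun ?_
  ext t
  have h1 : charFun ((gaussianVec d v).map (fun w => inner ℝ a w)) t
      = charFun (gaussianVec d v) (t • a) := by
    rw [charFun_apply, charFun_apply, integral_map (by fun_prop) (by fun_prop)]
    refine integral_congr_ae (.of_forall fun w => ?_)
    simp [inner_smul_right, real_inner_comm]
  have h2 : gaussianVec d v = (Measure.pi fun _ : Fin d => gaussianReal 0 v).map (WithLp.toLp 2) :=
    rfl
  rw [h1, h2, charFun_pi]
  simp_rw [charFun_gaussianReal]
  rw [← Complex.exp_sum]
  congr 1
  have h3 := EuclideanSpace.real_norm_sq_eq a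
  have h4 : ((‖a‖ : ℂ)) ^ 2 = ∑ i, (a i : ℂ) ^ 2 := by exact_mod_cast h3
  simp only [Complex.ofReal_zero, mul_zero, zero_mul, zero_sub, PiLp.smul_apply, smul_eq_mul,
    NNReal.coe_mul, NNReal.coe_pow, coe_nnnorm, Complex.ofReal_mul, Complex.ofReal_pow, h4]
  rw [Finset.mul_sum, Finset.sum_mul, Finset.sum_div, ← Finset.sum_neg_distrib]
  refine Finset.sum_congr rfl fun i _ => ?_
  ring

lemma gaussianReal_Ioi_zero_le (v : ℝ≥0) :
    gaussianReal 0 v (Set.Ioi 0) ≤ ENNReal.ofReal (1 / 2) := by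
  have h1 : gaussianReal 0 v (Set.Iio 0) = gaussianReal 0 v (Set.Ioi 0) := by
    conv_rhs => rw [← neg_zero (G := ℝ), ← gaussianReal_map_neg,
      Measure.map_apply (by fun_prop) measurableSet_Ioi]
    congr 1
    ext x; simp
  have h2 : gaussianReal 0 v (Set.Ioi 0) + gaussianReal 0 v (Set.Ioi 0) ≤ 1 := by
    conv_lhs => rw [← h1]
    nth_rw 2 [h1]
    rw [← measure_union (by rw [Set.disjoint_left]; intro x; simp; intro h; linarith)
      measurableSet_Ioi]
    exact prob_le_one
  rw [← two_mul] at h2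
  rw [one_div, ENNReal.ofReal_inv_of_pos (by norm_num), ENNReal.le_inv_iff_mul_le, mul_comm]
  simpa using h2

lemma gaussianReal_Ioi_le_exp {v : ℝ≥0} (hv : v ≠ 0) {s : ℝ} (hs : 0 ≤ s) :
    gaussianReal 0 v (Set.Ioi s) ≤ ENNReal.ofReal (Real.exp (-(s ^ 2 / (2 * v))) / 2) := by
  have hv' : (0 : ℝ) < v := by exact_mod_cast pos_iff_ne_zero.2 hv
  have h1 : gaussianReal 0 v (Set.Ioi s) = gaussianReal (-s) v (Set.Ioi 0) := by
    have := gaussianReal_map_const_add (μ := 0) (v := v) (-s)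
    rw [zero_add] at this
    rw [← this, Measure.map_apply (by fun_prop) measurableSet_Ioi]
    congr 1
    ext x; simp
  rw [h1, gaussianReal_eq_withDensity_exp _ hv, withDensity_apply _ measurableSet_Ioi]
  calc _ ≤ ∫⁻ x in Set.Ioi 0, ENNReal.ofReal (Real.exp (-(s ^ 2 / (2 * v))))
          ∂gaussianReal 0 v := by
        refine setLIntegral_mono measurable_const fun x hx => ?_
        refine ENNReal.ofReal_le_ofReal (Real.exp_le_exp.2 ?_)
        have : 0 ≤ s * x / v := div_nonneg (mul_nonneg hs (le_of_lt hx)) hv'.le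
        have e : (-s * x - (-s) ^ 2 / 2) / (v : ℝ) = -(s ^ 2 / (2 * v)) - s * x / v := by
          field_simp
          ring
        linarith
    _ ≤ _ := by
        rw [setLIntegral_const, div_eq_mul_one_div (Real.exp _),
          ENNReal.ofReal_mul (Real.exp_pos _).le]
        gcongr
        exact gaussianReal_Ioi_zero_le v

lemma gaussianReal_Ioi_le_add {v : ℝ≥0} (hv : v ≠ 0) {s b : ℝ} (hb : 0 ≤ b)
    (hs : s ≤ 0) (hsb : s ^ 2 ≤ b ^ 2 * v) :
    gaussianReal 0 v (Set.Ioi s) ≤ ENNReal.ofReal (1 / 2 + b) := by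
  have hv' : (0 : ℝ) < v := by exact_mod_cast pos_iff_ne_zero.2 hv
  have hsq : 0 < √(v : ℝ) := Real.sqrt_pos.2 hv'
  have hpdf : ∀ x, gaussianPDFReal 0 v x ≤ (√v)⁻¹ := fun x => by
    rw [gaussianPDFReal]
    calc _ ≤ (√(2 * Real.pi * v))⁻¹ * 1 := by
          gcongr
          rw [Real.exp_le_one_iff, neg_div]
          exact neg_nonpos.2 (by positivity)
      _ ≤ _ := by
          rw [mul_one]
          gcongr
          nlinarith [Real.pi_gt_three]
  have hs' : -s ≤ b * √v := by
    refine le_of_sq_le_sq ?_ (by positivity)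
    rwa [neg_sq, mul_pow, Real.sq_sqrt hv'.le]
  have hsmall : gaussianReal 0 v (Set.Ioc s 0) ≤ ENNReal.ofReal b := by
    rw [gaussianReal_apply _ hv]
    calc _ ≤ ∫⁻ x in Set.Ioc s 0, ENNReal.ofReal ((√v)⁻¹) :=
          lintegral_mono fun x => ENNReal.ofReal_le_ofReal (hpdf x)
      _ = ENNReal.ofReal ((√v)⁻¹ * (0 - s)) := by
          rw [setLIntegral_const, Real.volume_Ioc, ENNReal.ofReal_mul (by positivity)]
      _ ≤ _ := by
          refine ENNReal.ofReal_le_ofReal ?_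
          rw [inv_mul_le_iff₀ hsq]
          linarith
  rw [← Set.Ioc_union_Ioi_eq_Ioi hs, ENNReal.ofReal_add (by norm_num) hb, add_comm]
  exact (measure_union_le _ _).trans (add_le_add hsmall (gaussianReal_Ioi_zero_le v))

/-- The tail bound behind the Gaussian mechanism: `A` is the squared sensitivity. -/
lemma gaussianReal_privacyLoss_tail_le {v V : ℝ≥0} {A ε δ : ℝ} (hv : 0 < (v : ℝ)) (hA : 0 < A)
    (hV : (V : ℝ) = v * A) (hε : 0 < ε) (hε1 : ε < 1) (hδ : 0 < δ) (hδ1 : δ < 1)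
    (h : 2 * A * Real.log (1.25 / δ) ≤ ε ^ 2 * v) :
    gaussianReal 0 V (Set.Ioi (ε * v - A / 2)) ≤ ENNReal.ofReal δ := by
  have hVpos : (0 : ℝ) < V := by rw [hV]; positivity
  have hV0 : V ≠ 0 := by rintro rfl; simp at hVpos
  set L := Real.log (1.25 / δ) with hL
  have hexp : Real.exp (-L) = δ / 1.25 := by
    rw [hL, Real.exp_neg, Real.exp_log (by positivity), inv_div]
  rcases le_total 0 (ε * v - A / 2) with hs | hs
  · refine (gaussianReal_Ioi_le_exp hV0 hs).trans (ENNReal.ofReal_le_ofReal ?_)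
    have hsq : L - 1 / 2 ≤ (ε * v - A / 2) ^ 2 / (2 * V) := by
      rw [le_div_iff₀ (by positivity), hV]
      have : 0 < v * A := by exact_mod_cast hV ▸ hVpos
      nlinarith [mul_le_mul_of_nonneg_right h hv.le, mul_pos hv hA, sq_nonneg A]
    have h1 : Real.exp (-((ε * v - A / 2) ^ 2 / (2 * V))) ≤ Real.exp (1 / 2) * (δ / 1.25) := by
      rw [← hexp, ← Real.exp_add]
      exact Real.exp_le_exp.2 (by linarith)
    have h2 : Real.exp (1 / 2) ≤ 2 := by
      have h3 : Real.exp (1 / 2) ^ 2 = Real.exp 1 := by rw [← Real.exp_nat_mul]; norm_num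
      nlinarith [Real.exp_one_lt_d9, Real.exp_pos (1 / 2)]
    have h4 := mul_le_mul_of_nonneg_right h2 (show 0 ≤ δ / 1.25 by positivity)
    have h5 : 2 * (δ / 1.25) ≤ δ * 2 := by
      rw [mul_comm δ]
      gcongr
      exact div_le_self hδ.le (by norm_num)
    rw [div_le_iff₀ two_pos]
    exact (h1.trans h4).trans h5
  · have hL1 : 1 / 5 ≤ L := by
      have := Real.one_sub_inv_le_log_of_pos (x := 1.25 / δ) (by positivity)
      rw [inv_div] at this
      norm_num at this
      linarith
    have hA1 : A ≤ 2.5 * (ε ^ 2 * v) := by nlinarith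
    have hA2 : A ≤ 2.5 * (ε * v) := by nlinarith [mul_pos hε hv]
    have hL2 : L ≤ 1 / 4 := by
      by_contra hc
      push Not at hc
      nlinarith [mul_pos hε hv, mul_pos hA (sub_pos.2 hc)]
    have hδ2 : 0.9 ≤ δ := by
      have := Real.add_one_le_exp (-L)
      rw [hexp, le_div_iff₀ (by norm_num)] at this
      linarith
    refine (gaussianReal_Ioi_le_add (b := 0.2) hV0 (by norm_num) hs ?_).trans
      (ENNReal.ofReal_le_ofReal (by linarith))
    have e1 : A / 2 - ε * v ≤ A / 8 * 1 := by linarith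
    have e2 : A / 2 - ε * v ≤ v / 4 := by nlinarith
    have := mul_le_mul e1 e2 (by linarith) (by positivity)
    rw [hV]
    nlinarith [mul_pos hv hA]

/-- The Gaussian mechanism is differentially private for `ℓ2`-close centers. -/
lemma gaussianMech_dp {d : ℕ} {v : ℝ≥0} {c c' : EuclideanSpace ℝ (Fin d)} {ε δ : ℝ}
    (hε : 0 < ε) (hε1 : ε < 1) (hδ : 0 < δ) (hδ1 : δ < 1)
    (h : 2 * ‖c - c'‖ ^ 2 * Real.log (1.25 / δ) ≤ ε ^ 2 * v)
    {S : Set (EuclideanSpace ℝ (Fin d))} (hS : MeasurableSet S) :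
    gaussianMech v c S ≤ ENNReal.ofReal (Real.exp ε) * gaussianMech v c' S
      + ENNReal.ofReal δ := by
  rcases eq_or_ne c c' with rfl | hcc
  · refine le_add_right (le_mul_of_one_le_left' ?_)
    rw [ENNReal.one_le_ofReal]
    exact Real.one_le_exp hε.le
  set a := c - c' with ha
  have hA : 0 < ‖a‖ ^ 2 := by
    have := norm_pos_iff.2 (sub_ne_zero.2 hcc)
    positivity
  have hlog : 0 < Real.log (1.25 / δ) :=
    Real.log_pos (by rw [lt_div_iff₀ hδ]; linarith)
  have hv : 0 < (v : ℝ) := by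
    have : 0 < ε ^ 2 * (v : ℝ) := lt_of_lt_of_le (by positivity) h
    exact pos_of_mul_pos_right this (by positivity)
  have hv0 : v ≠ 0 := by rintro rfl; simp at hv
  set T := (fun w => c' + w) ⁻¹' S with hT
  have hTm : MeasurableSet T := hS.preimage (by fun_prop)
  have e1 : gaussianMech v c S = gaussianMech v a T := by
    rw [gaussianMech, gaussianMech, Measure.map_apply (by fun_prop) hS,
      Measure.map_apply (by fun_prop) hTm]
    congr 1
    ext w
    simp [hT, ha, ← add_assoc]
  have e2 : gaussianMech v c' S = gaussianVec d v T := by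
    rw [gaussianMech, Measure.map_apply (by fun_prop) hS]
  set B : Set (EuclideanSpace ℝ (Fin d)) := {w | ε * v + ‖a‖ ^ 2 / 2 < inner ℝ a w} with hB
  have hBm : MeasurableSet B := measurableSet_lt (by fun_prop) (by fun_prop)
  have hgood : gaussianMech v a (T \ B) ≤ ENNReal.ofReal (Real.exp ε) * gaussianVec d v T := by
    rw [gaussianMech_eq_withDensity hv0, withDensity_apply _ (hTm.diff hBm)]
    calc _ ≤ ∫⁻ w in T \ B, ENNReal.ofReal (Real.exp ε) ∂gaussianVec d v := by
          refine setLIntegral_mono measurable_const fun w hw => ?_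
          refine ENNReal.ofReal_le_ofReal (Real.exp_le_exp.2 ?_)
          have := hw.2
          simp only [hB, Set.mem_ofPred_eq, not_lt] at this
          rw [div_le_iff₀ hv]
          linarith
      _ ≤ _ := by
          rw [setLIntegral_const]
          gcongr
          exact Set.sdiff_subset
  have hbad : gaussianMech v a B ≤ ENNReal.ofReal δ := by
    have : (fun w => a + w) ⁻¹' B = (fun w => inner ℝ a w) ⁻¹' Set.Ioi (ε * v - ‖a‖ ^ 2 / 2) := by
      ext w
      simp only [hB, Set.mem_preimage, Set.mem_ofPred_eq, Set.mem_Ioi, inner_add_right,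
        real_inner_self_eq_norm_sq]
      constructor <;> intro h <;> linarith
    rw [gaussianMech, Measure.map_apply (by fun_prop) hBm, this,
      ← Measure.map_apply (by fun_prop) measurableSet_Ioi, map_inner_gaussianVec]
    exact gaussianReal_privacyLoss_tail_le hv hA (by simp) hε hε1 hδ hδ1 h
  rw [e1, e2]
  calc gaussianMech v a T ≤ gaussianMech v a (T \ B ∪ B) := by
        gcongr
        exact Set.subset_sdiff_union T B
    _ ≤ _ := (measure_union_le _ _).trans (add_le_add hgood hbad)

lemma EuclideanSpace.norm_le_sum_abs {d : ℕ} (a : EuclideanSpace ℝ (Fin d)) :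
    ‖a‖ ≤ ∑ i, |a i| := by
  refine le_of_sq_le_sq ?_ (Finset.sum_nonneg fun i _ => abs_nonneg _)
  rw [EuclideanSpace.real_norm_sq_eq]
  simpa using Finset.sum_sq_le_sq_sum_of_nonneg (s := Finset.univ) (fun i _ => abs_nonneg (a i))

lemma gradient_inv_mul_sum {E : Type*} [NormedAddCommGroup E] [InnerProductSpace ℝ E]
    [CompleteSpace E] {ι : Type*} [Fintype ι] (f : ι → E → ℝ)
    {x : E} (hf : ∀ j, DifferentiableAt ℝ (f j) x) (r : ℝ) :
    gradient (fun θ => r * ∑ j, f j θ) x = r • ∑ j, gradient (f j) x := by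
  have h : fderiv ℝ (fun θ => r * ∑ j, f j θ) x = r • ∑ j, fderiv ℝ (f j) x := by
    rw [fderiv_const_mul (DifferentiableAt.fun_sum fun j _ => hf j),
      fderiv_fun_sum fun j _ => hf j]
  simp [gradient, h]

/-- **Differential privacy for data samples** (Theorem 4 of the paper).
Agent `i`'s objective is `f_i(θ; D) = (1/n)∑_j ℓ(θ, s_j)` and the shared (pre-noise)
message at iteration `k` is `x_i^k - λ^k ∇f_i(x_i^k; D)`, perturbed by Gaussian noise of
covariance `σ² I_d`.  If the per-sample gradient is `ν`-Lipschitz in the sample in the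
`ℓ1` norm and `σ² ≥ 2ν²(λ^k)² ln(1.25/δ)/(n² ε²)`, the mechanism is
`(ε, δ)`-differentially private w.r.t. datasets differing in one sample at `ℓ1`-distance
at most `1`. -/
theorem dp_data_samples
    {d n p : ℕ} (hn : 0 < n)
    (ℓ : EuclideanSpace ℝ (Fin d) → (Fin p → ℝ) → ℝ)
    (hdiff : ∀ s, Differentiable ℝ (fun θ => ℓ θ s))
    (ν : ℝ) (hν : 0 ≤ ν)
    (hLip : ∀ (θ : EuclideanSpace ℝ (Fin d)) (s s' : Fin p → ℝ),
      ∑ j, |gradient (fun u => ℓ u s) θ j - gradient (fun u => ℓ u s') θ j|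
        ≤ ν * ∑ t, |s t - s' t|)
    (x : EuclideanSpace ℝ (Fin d)) (lam : ℝ) (hlam : 0 < lam)
    (σ2 : ℝ≥0) (ε δ : ℝ) (hε : 0 < ε) (hε1 : ε < 1) (hδ : 0 < δ) (hδ1 : δ < 1)
    (hσ : 2 * ν ^ 2 * lam ^ 2 * Real.log (1.25 / δ) / ((n : ℝ) ^ 2 * ε ^ 2) ≤ (σ2 : ℝ))
    (D D' : Fin n → Fin p → ℝ)
    (hadj : ∃ q : Fin n, (∀ j, j ≠ q → D j = D' j) ∧ ∑ t, |D q t - D' q t| ≤ 1)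
    (S : Set (EuclideanSpace ℝ (Fin d))) (hS : MeasurableSet S) :
    gaussianMech σ2 (x - lam • gradient (fun θ => (n : ℝ)⁻¹ * ∑ j, ℓ θ (D j)) x) S
      ≤ ENNReal.ofReal (Real.exp ε) *
          gaussianMech σ2 (x - lam • gradient (fun θ => (n : ℝ)⁻¹ * ∑ j, ℓ θ (D' j)) x) S
        + ENNReal.ofReal δ := by
  obtain ⟨q, hq, hq1⟩ := hadj
  refine gaussianMech_dp hε hε1 hδ hδ1 ?_ hS
  have hn' : (0 : ℝ) < n := by exact_mod_cast hn
  have hlog : 0 < Real.log (1.25 / δ) :=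
    Real.log_pos (by rw [lt_div_iff₀ hδ]; linarith)
  set G : (Fin p → ℝ) → EuclideanSpace ℝ (Fin d) := fun s => gradient (fun θ => ℓ θ s) x with hG
  rw [gradient_inv_mul_sum (fun j θ => ℓ θ (D j)) (fun j => hdiff _ x),
    gradient_inv_mul_sum (fun j θ => ℓ θ (D' j)) (fun j => hdiff _ x)]
  have hsum : ∑ j, G (D' j) - ∑ j, G (D j) = G (D' q) - G (D q) := by
    rw [← Finset.sum_sub_distrib]
    exact Finset.sum_eq_single q (fun j _ hj => by rw [hq j hj, sub_self]) (by simp)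
  have hdiffc : (x - lam • (n : ℝ)⁻¹ • ∑ j, G (D j)) - (x - lam • (n : ℝ)⁻¹ • ∑ j, G (D' j))
      = (lam * (n : ℝ)⁻¹) • (G (D' q) - G (D q)) := by
    rw [← hsum, smul_sub, mul_smul, mul_smul]
    abel
  have hGq : ‖G (D' q) - G (D q)‖ ≤ ν := by
    rw [norm_sub_rev]
    refine (EuclideanSpace.norm_le_sum_abs _).trans ((hLip x (D q) (D' q)).trans ?_)
    exact mul_le_of_le_one_right hν hq1
  change 2 * ‖(x - lam • (n : ℝ)⁻¹ • ∑ j, G (D j)) - (x - lam • (n : ℝ)⁻¹ • ∑ j, G (D' j))‖ ^ 2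
    * _ ≤ _
  rw [hdiffc, norm_smul, Real.norm_of_nonneg (by positivity)]
  rw [div_le_iff₀ (by positivity)] at hσ
  calc 2 * (lam * (n : ℝ)⁻¹ * ‖G (D' q) - G (D q)‖) ^ 2 * Real.log (1.25 / δ)
      ≤ 2 * (lam * (n : ℝ)⁻¹ * ν) ^ 2 * Real.log (1.25 / δ) := by gcongr
    _ = 2 * ν ^ 2 * lam ^ 2 * Real.log (1.25 / δ) / (n : ℝ) ^ 2 := by field_simp
    _ ≤ ε ^ 2 * σ2 := by
        rw [div_le_iff₀ (by positivity)]
        linarith
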